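/- Let d ≥ 2 and let A be any d²×d² complex matrix. Let S denote the swap operator on ℂ^d ⊗ ℂ^d (the d²×d² matrix with S (x ⊗ y) = y ⊗ x). Then the Haar second-moment twirl is given exactly by ∫_{U(d)} (U ⊗ U) · A · (U ⊗ U)ᴴ dμ(U) = α • I + β • S, where α = (d · tr A − tr(S·A)) / (d·(d² − 1)) and β = (d · tr(S·A) − tr A) / (d·(d² − 1)). (This identifies the map G_H(A) = ∫ U^{⊗2} A (Uᴴ)^{⊗2} dμ that defines exact unitary 2-designs.) -/

import Mathlib

open MeasureTheory Matrix
open scoped Matrix Kronecker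

noncomputable instance (d : ℕ) : MeasurableSpace (Matrix.unitaryGroup (Fin d) ℂ) := borel _
instance (d : ℕ) : BorelSpace (Matrix.unitaryGroup (Fin d) ℂ) := ⟨rfl⟩

attribute [local instance] Matrix.normedAddCommGroup Matrix.normedSpace

instance (d : ℕ) : CompactSpace (Matrix.unitaryGroup (Fin d) ℂ) := by
  have hclosed : IsClosed (unitary (Matrix (Fin d) (Fin d) ℂ) : Set (Matrix (Fin d) (Fin d) ℂ)) :=
    isClosed_unitary
  refine isCompact_iff_compactSpace.1 (Metric.isCompact_of_isClosed_isBounded hclosed ?_)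
  exact (Metric.isBounded_closedBall (x := (0 : Matrix (Fin d) (Fin d) ℂ)) (r := 1)).subset
    fun U hU => mem_closedBall_zero_iff.2 (entrywise_sup_norm_bound_of_unitary hU)

theorem LinearMap.map_integral_of_continuous {X E F : Type*} [TopologicalSpace X]
    [CompactSpace X] [MeasurableSpace X] [OpensMeasurableSpace X] {μ : Measure X}
    [IsFiniteMeasure μ] [NormedAddCommGroup E] [NormedSpace ℂ E] [FiniteDimensional ℂ E]
    [NormedAddCommGroup F] [NormedSpace ℂ F] [CompleteSpace F] (L : E →ₗ[ℂ] F) {f : X → E}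
    (hf : Continuous f) : L (∫ x, f x ∂μ) = ∫ x, L (f x) ∂μ := by
  have := FiniteDimensional.complete ℂ E
  exact (L.toContinuousLinearMap.integral_comp_comm
    (hf.integrable_of_hasCompactSupport (HasCompactSupport.of_compactSpace _))).symm

section Commutant

variable {n : Type*} [Fintype n] [DecidableEq n]

/-- The swap operator on `ℂⁿ ⊗ ℂⁿ`. -/
def swapMatrix (n : Type*) [DecidableEq n] : Matrix (n × n) (n × n) ℂ :=
  Matrix.of fun p q => if p = q.swap then 1 else 0

theorem eq_swapMatrix_of_mulVec {S : Matrix (n × n) (n × n) ℂ}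
    (hS : ∀ x y : n → ℂ, S *ᵥ (fun p : n × n => x p.1 * y p.2) =
      fun p : n × n => y p.1 * x p.2) : S = swapMatrix n := by
  ext p ⟨k, l⟩
  have h := congrFun (hS (Pi.single k 1) (Pi.single l 1)) p
  have hsingle : (fun p : n × n => (Pi.single k 1 : n → ℂ) p.1 * (Pi.single l 1 : n → ℂ) p.2) =
      Pi.single (k, l) 1 := by
    ext ⟨a, b⟩
    simp only [Pi.single_apply, Prod.mk.injEq]
    grind
  rw [hsingle, Matrix.mulVec_single_one] at h
  rw [Matrix.col_apply] at h
  rw [h]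
  obtain ⟨a, b⟩ := p
  simp only [swapMatrix, Matrix.of_apply, Pi.single_apply, Prod.swap_prod_mk, Prod.mk.injEq]
  grind

theorem swapMatrix_mul_apply (M : Matrix (n × n) (n × n) ℂ) (p q : n × n) :
    (swapMatrix n * M) p q = M p.swap q := by
  rw [Matrix.mul_apply, Finset.sum_eq_single p.swap]
  · simp [swapMatrix]
  · intro r _ hr
    have : p ≠ r.swap := fun h => hr (by simp [h])
    simp [swapMatrix, this]
  · simp

theorem mul_swapMatrix_apply (M : Matrix (n × n) (n × n) ℂ) (p q : n × n) :
    (M * swapMatrix n) p q = M p q.swap := by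
  rw [Matrix.mul_apply, Finset.sum_eq_single q.swap]
  · simp [swapMatrix]
  · intro r _ hr
    simp [swapMatrix, hr]
  · simp

theorem swapMatrix_mul_self : swapMatrix n * swapMatrix n = 1 := by
  ext p q
  rw [swapMatrix_mul_apply]
  simp [swapMatrix, Matrix.one_apply]

theorem trace_swapMatrix : (swapMatrix n).trace = Fintype.card n := by
  simp only [Matrix.trace, Matrix.diag, Fintype.sum_prod_type, swapMatrix, Matrix.of_apply,
    Prod.swap_prod_mk, Prod.mk.injEq]
  have (x y : n) : (if x = y ∧ y = x then (1 : ℂ) else 0) = if x = y then 1 else 0 := by grind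
  simp [this]

theorem swapMatrix_mul_kronecker_self (V : Matrix n n ℂ) :
    swapMatrix n * (V ⊗ₖ V) = (V ⊗ₖ V) * swapMatrix n := by
  ext p q
  simp [swapMatrix_mul_apply, mul_swapMatrix_apply, mul_comm]

theorem diagonal_mem_unitaryGroup {v : n → ℂ} (hv : ∀ i, v i * star (v i) = 1) :
    Matrix.diagonal v ∈ Matrix.unitaryGroup n ℂ := by
  rw [Matrix.mem_unitaryGroup_iff, Matrix.star_eq_conjTranspose, Matrix.diagonal_conjTranspose,
    Matrix.diagonal_mul_diagonal, ← Matrix.diagonal_one]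
  congr 1
  ext i
  exact hv i

theorem permMatrix_mem_unitaryGroup (σ : Equiv.Perm n) :
    σ.permMatrix ℂ ∈ Matrix.unitaryGroup n ℂ := by
  rw [Matrix.mem_unitaryGroup_iff, Matrix.star_eq_conjTranspose, Matrix.conjTranspose_permMatrix,
    ← Matrix.permMatrix_mul]
  simp

/-- The unitary that multiplies the uniform vector by `i` and fixes its orthogonal complement.
All of its entries are nonzero. -/
noncomputable def uniformPhase (n : Type*) [Fintype n] [DecidableEq n] : Matrix n n ℂ :=
  1 + ((Complex.I - 1) / (Fintype.card n : ℂ)) • Matrix.of fun _ _ => 1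

theorem uniformPhase_mem_unitaryGroup [Nonempty n] :
    uniformPhase n ∈ Matrix.unitaryGroup n ℂ := by
  rw [Matrix.mem_unitaryGroup_iff, Matrix.star_eq_conjTranspose]
  have hn : (Fintype.card n : ℂ) ≠ 0 := by exact_mod_cast Fintype.card_ne_zero
  have hJ : (Matrix.of fun _ _ => 1 : Matrix n n ℂ)ᴴ = Matrix.of fun _ _ => 1 := by
    ext; simp
  have hJJ : (Matrix.of fun _ _ => 1 : Matrix n n ℂ) * (Matrix.of fun _ _ => 1) =
      (Fintype.card n : ℂ) • Matrix.of fun _ _ => 1 := by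
    ext; simp [Matrix.mul_apply]
  have hstar : star ((Complex.I - 1) / (Fintype.card n : ℂ)) =
      (-Complex.I - 1) / (Fintype.card n : ℂ) := by
    simp
  simp only [uniformPhase, Matrix.conjTranspose_add, Matrix.conjTranspose_smul, hJ, hstar, add_mul,
    mul_add, Matrix.smul_mul, Matrix.mul_smul, hJJ, Matrix.conjTranspose_one, one_mul, mul_one,
    smul_smul, add_assoc, ← add_smul]
  convert add_zero _
  convert zero_smul ℂ _
  field_simp
  linear_combination -Complex.I_sq

variable {T : Matrix (n × n) (n × n) ℂ}

theorem commutant_apply_eq_zero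
    (hT : ∀ V ∈ Matrix.unitaryGroup n ℂ, (V ⊗ₖ V) * T = T * (V ⊗ₖ V))
    {p q : n × n} (h : q ≠ p) (h' : q ≠ p.swap) : T p q = 0 := by
  obtain ⟨i, j⟩ := p
  obtain ⟨k, l⟩ := q
  have key (m : n) := congrFun₂ (hT (Matrix.diagonal fun x => if x = m then Complex.I else 1)
    (diagonal_mem_unitaryGroup fun x => by split_ifs <;> simp)) (i, j) (k, l)
  simp only [Matrix.diagonal_kronecker_diagonal, Matrix.diagonal_mul, Matrix.mul_diagonal] at key
  have cancel {a b : ℂ} (hab : a ≠ b) (e : a * T (i, j) (k, l) = T (i, j) (k, l) * b) :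
      T (i, j) (k, l) = 0 := by
    have : (a - b) * T (i, j) (k, l) = 0 := by linear_combination e
    exact (mul_eq_zero.1 this).resolve_left (sub_ne_zero.2 hab)
  have hI : Complex.I ≠ 1 := fun e => by simpa using congrArg Complex.im e
  have hI2 : Complex.I * Complex.I ≠ 1 := by norm_num [Complex.I_mul_I]
  have hII : Complex.I * Complex.I ≠ Complex.I := fun e => by simpa using congrArg Complex.im e
  simp only [ne_eq, Prod.mk.injEq, Prod.swap_prod_mk] at h h'
  by_cases hi : i = k ∨ i = l
  · refine cancel ?_ (key j)
    grind
  · refine cancel ?_ (key i)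
    grind

theorem commutant_apply_perm
    (hT : ∀ V ∈ Matrix.unitaryGroup n ℂ, (V ⊗ₖ V) * T = T * (V ⊗ₖ V))
    (σ : Equiv.Perm n) (i j k l : n) : T (σ i, σ j) (σ k, σ l) = T (i, j) (k, l) := by
  have key := congrFun₂ (hT _ (permMatrix_mem_unitaryGroup σ)) (i, j) (σ k, σ l)
  simpa [Matrix.mul_apply, Fintype.sum_prod_type, Equiv.Perm.permMatrix, PEquiv.toMatrix_apply,
    ite_and] using key

theorem exists_perm_apply_pair {n : Type*} [DecidableEq n] {i j k l : n} (hij : i ≠ j) (hkl : k ≠ l) :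
    ∃ σ : Equiv.Perm n, σ i = k ∧ σ j = l := by
  refine ⟨Equiv.swap (Equiv.swap i k j) l * Equiv.swap i k, ?_, ?_⟩
  · rw [Equiv.Perm.mul_apply, Equiv.swap_apply_left]
    apply Equiv.swap_apply_of_ne_of_ne _ hkl
    intro h
    exact hij ((Equiv.swap i k).injective (by rw [Equiv.swap_apply_left, ← h]))
  · simp

theorem commutant_apply_add
    (hT : ∀ V ∈ Matrix.unitaryGroup n ℂ, (V ⊗ₖ V) * T = T * (V ⊗ₖ V))
    {i j : n} (hij : i ≠ j) :
    T (i, i) (i, i) = T (i, j) (i, j) + T (i, j) (j, i) := by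
  have : Nonempty n := ⟨i⟩
  have key := congrFun₂ (hT _ uniformPhase_mem_unitaryGroup) (i, j) (i, i)
  rw [Matrix.mul_apply, Matrix.mul_apply, Finset.sum_eq_single (i, i),
    Finset.sum_eq_add (i, j) (j, i)] at key
  · simp only [Matrix.kroneckerMap_apply] at key
    have h0 : uniformPhase n i i * uniformPhase n j i ≠ 0 := by
      have hn : (Fintype.card n : ℂ) ≠ 0 := by exact_mod_cast Fintype.card_ne_zero
      have hI : Complex.I - 1 ≠ 0 := fun e => by simpa using congrArg Complex.im e
      simp only [uniformPhase, Matrix.add_apply, Matrix.one_apply_eq, Matrix.smul_apply,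
        Matrix.of_apply, Matrix.one_apply_ne hij.symm, smul_eq_mul, mul_one, zero_add]
      refine mul_ne_zero (fun e => ?_) (div_ne_zero hI hn)
      field_simp at e
      simpa using congrArg Complex.im e
    apply mul_left_cancel₀ h0
    linear_combination key
  · simp [hij]
  · intro q _ hq
    rw [commutant_apply_eq_zero hT hq.1 hq.2, zero_mul]
  · simp
  · simp
  · intro q _ hq
    rw [commutant_apply_eq_zero hT hq.symm, mul_zero]
    intro h
    exact hq (by rw [← Prod.swap_swap q, ← h]; rfl)
  · simp

/-- The commutant of `{V ⊗ V | V unitary}` is spanned by the identity and the swap. -/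
theorem exists_eq_smul_one_add_smul_swapMatrix [Nontrivial n]
    (hT : ∀ V ∈ Matrix.unitaryGroup n ℂ, (V ⊗ₖ V) * T = T * (V ⊗ₖ V)) :
    ∃ a b : ℂ, T = a • 1 + b • swapMatrix n := by
  obtain ⟨k, l, hkl⟩ := exists_pair_ne n
  refine ⟨T (k, l) (k, l), T (k, l) (l, k), ?_⟩
  have hconst {i j : n} (hij : i ≠ j) : T (i, j) (i, j) = T (k, l) (k, l) ∧
      T (i, j) (j, i) = T (k, l) (l, k) := by
    obtain ⟨σ, rfl, rfl⟩ := exists_perm_apply_pair hij hkl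
    exact ⟨(commutant_apply_perm hT σ i j i j).symm, (commutant_apply_perm hT σ i j j i).symm⟩
  ext ⟨i, j⟩ q
  simp only [Matrix.add_apply, Matrix.smul_apply, swapMatrix, Matrix.of_apply, Matrix.one_apply,
    smul_eq_mul, mul_ite, mul_one, mul_zero]
  by_cases hq : q = (i, j)
  · subst hq
    by_cases hij : i = j
    · subst hij
      obtain ⟨m, hm⟩ := exists_ne i
      simp [commutant_apply_add hT hm.symm, hconst hm.symm]
    · simp [hconst hij, hij]
  · by_cases hq' : q = (j, i)
    · subst hq'
      have hij : i ≠ j := fun h => hq (by simp [h])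
      simp [hconst hij, hij]
    · rw [commutant_apply_eq_zero hT hq hq', if_neg (Ne.symm hq), if_neg, add_zero]
      intro h
      exact hq' (by rw [← Prod.swap_swap q, ← h]; rfl)

end Commutant

theorem conjTranspose_kronecker_self_mul {n : Type*} [Fintype n] [DecidableEq n]
    {V : Matrix n n ℂ} (hV : V ∈ Matrix.unitaryGroup n ℂ) : (V ⊗ₖ V)ᴴ * (V ⊗ₖ V) = 1 := by
  rw [Matrix.conjTranspose_kronecker, ← Matrix.mul_kronecker_mul, ← Matrix.star_eq_conjTranspose,
    Matrix.mem_unitaryGroup_iff'.1 hV, Matrix.one_kronecker_one]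

section Twirl

variable {d : ℕ} (μ : Measure (Matrix.unitaryGroup (Fin d) ℂ))
  (A : Matrix (Fin d × Fin d) (Fin d × Fin d) ℂ)

theorem continuous_twirl :
    Continuous fun U : Matrix.unitaryGroup (Fin d) ℂ =>
      ((U : Matrix (Fin d) (Fin d) ℂ) ⊗ₖ (U : Matrix (Fin d) (Fin d) ℂ)) * A *
        ((U : Matrix (Fin d) (Fin d) ℂ) ⊗ₖ (U : Matrix (Fin d) (Fin d) ℂ))ᴴ := by
  have hcont : Continuous fun U : Matrix.unitaryGroup (Fin d) ℂ =>
      (U : Matrix (Fin d) (Fin d) ℂ) ⊗ₖ (U : Matrix (Fin d) (Fin d) ℂ) := by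
    refine continuous_matrix fun p q => ?_
    exact (continuous_subtype_val.matrix_elem _ _).mul (continuous_subtype_val.matrix_elem _ _)
  exact (hcont.matrix_mul continuous_const).matrix_mul hcont.matrix_conjTranspose

theorem map_twirl [IsProbabilityMeasure μ] {F : Type*} [NormedAddCommGroup F] [NormedSpace ℂ F]
    [CompleteSpace F] (L : Matrix (Fin d × Fin d) (Fin d × Fin d) ℂ →ₗ[ℂ] F) :
    L (∫ U, ((U : Matrix (Fin d) (Fin d) ℂ) ⊗ₖ (U : Matrix (Fin d) (Fin d) ℂ)) * A *
        ((U : Matrix (Fin d) (Fin d) ℂ) ⊗ₖ (U : Matrix (Fin d) (Fin d) ℂ))ᴴ ∂μ) =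
      ∫ U, L (((U : Matrix (Fin d) (Fin d) ℂ) ⊗ₖ (U : Matrix (Fin d) (Fin d) ℂ)) * A *
        ((U : Matrix (Fin d) (Fin d) ℂ) ⊗ₖ (U : Matrix (Fin d) (Fin d) ℂ))ᴴ) ∂μ :=
  L.map_integral_of_continuous (continuous_twirl A)

theorem kronecker_mul_twirl [IsProbabilityMeasure μ] [μ.IsMulLeftInvariant]
    {V : Matrix (Fin d) (Fin d) ℂ} (hV : V ∈ Matrix.unitaryGroup (Fin d) ℂ) :
    (V ⊗ₖ V) * (∫ U, ((U : Matrix (Fin d) (Fin d) ℂ) ⊗ₖ (U : Matrix (Fin d) (Fin d) ℂ)) * A *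
        ((U : Matrix (Fin d) (Fin d) ℂ) ⊗ₖ (U : Matrix (Fin d) (Fin d) ℂ))ᴴ ∂μ) =
      (∫ U, ((U : Matrix (Fin d) (Fin d) ℂ) ⊗ₖ (U : Matrix (Fin d) (Fin d) ℂ)) * A *
        ((U : Matrix (Fin d) (Fin d) ℂ) ⊗ₖ (U : Matrix (Fin d) (Fin d) ℂ))ᴴ ∂μ) * (V ⊗ₖ V) := by
  set W := V ⊗ₖ V with hW
  have h := map_twirl μ A (LinearMap.mulLeftRight ℂ (W, Wᴴ))
  simp only [LinearMap.mulLeftRight_apply] at h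
  have hinv := integral_mul_left_eq_self (μ := μ) (fun U : Matrix.unitaryGroup (Fin d) ℂ =>
    ((U : Matrix (Fin d) (Fin d) ℂ) ⊗ₖ (U : Matrix (Fin d) (Fin d) ℂ)) * A *
        ((U : Matrix (Fin d) (Fin d) ℂ) ⊗ₖ (U : Matrix (Fin d) (Fin d) ℂ))ᴴ) ⟨V, hV⟩
  simp only [Submonoid.coe_mul, Matrix.mul_kronecker_mul, Matrix.conjTranspose_mul, ← hW] at hinv
  simp only [Matrix.mul_assoc] at h hinv ⊢
  rw [hinv] at h
  nth_rewrite 2 [← h]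
  simp only [Matrix.mul_assoc]
  rw [conjTranspose_kronecker_self_mul hV, Matrix.mul_one]

theorem trace_mul_twirl [IsProbabilityMeasure μ] (B : Matrix (Fin d × Fin d) (Fin d × Fin d) ℂ)
    (hB : ∀ V : Matrix (Fin d) (Fin d) ℂ, B * (V ⊗ₖ V) = (V ⊗ₖ V) * B) :
    (B * ∫ U, ((U : Matrix (Fin d) (Fin d) ℂ) ⊗ₖ (U : Matrix (Fin d) (Fin d) ℂ)) * A *
        ((U : Matrix (Fin d) (Fin d) ℂ) ⊗ₖ (U : Matrix (Fin d) (Fin d) ℂ))ᴴ ∂μ).trace =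
      (B * A).trace := by
  have h := map_twirl μ A (Matrix.traceLinearMap _ ℂ ℂ ∘ₗ LinearMap.mulLeft ℂ B)
  simp only [LinearMap.comp_apply, LinearMap.mulLeft_apply, Matrix.traceLinearMap_apply] at h
  rw [h]
  have hconst (U : Matrix.unitaryGroup (Fin d) ℂ) :
      (B * (((U : Matrix (Fin d) (Fin d) ℂ) ⊗ₖ (U : Matrix (Fin d) (Fin d) ℂ)) * A *
        ((U : Matrix (Fin d) (Fin d) ℂ) ⊗ₖ (U : Matrix (Fin d) (Fin d) ℂ))ᴴ)).trace =
      (B * A).trace := by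
    rw [← Matrix.mul_assoc, ← Matrix.mul_assoc, hB, Matrix.trace_mul_comm, ← Matrix.mul_assoc,
      ← Matrix.mul_assoc, conjTranspose_kronecker_self_mul U.2, Matrix.one_mul]
  simp [hconst]

end Twirl

/-- **Exact Haar second-moment twirl (the map defining exact unitary 2-designs).**
Let `d ≥ 2`, let `μ` be the Haar probability measure on `U(d)` (a left- and right-invariant
Borel probability measure), and let `A` be any `d² × d²` complex matrix.  Let `S` be the swap
operator on `ℂᵈ ⊗ ℂᵈ`, i.e. the `d² × d²` matrix with `S (x ⊗ y) = y ⊗ x` for all vectors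
`x, y`.  Then `∫_{U(d)} (U ⊗ U) A (U ⊗ U)ᴴ dμ(U) = α • I + β • S` where
`α = (d tr A - tr(S A)) / (d (d² - 1))` and `β = (d tr(S A) - tr A) / (d (d² - 1))`. -/
theorem haar_second_moment_twirl (d : ℕ) (hd : 2 ≤ d)
    (μ : Measure (Matrix.unitaryGroup (Fin d) ℂ)) [IsProbabilityMeasure μ]
    [μ.IsMulLeftInvariant] [μ.IsMulRightInvariant]
    (A : Matrix (Fin d × Fin d) (Fin d × Fin d) ℂ)
    (S : Matrix (Fin d × Fin d) (Fin d × Fin d) ℂ)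
    (hS : ∀ x y : Fin d → ℂ,
      S *ᵥ (fun p : Fin d × Fin d => x p.1 * y p.2) =
        fun p : Fin d × Fin d => y p.1 * x p.2) :
    ∫ U, ((U : Matrix (Fin d) (Fin d) ℂ) ⊗ₖ (U : Matrix (Fin d) (Fin d) ℂ)) * A *
        ((U : Matrix (Fin d) (Fin d) ℂ) ⊗ₖ (U : Matrix (Fin d) (Fin d) ℂ))ᴴ ∂μ =
      (((d : ℂ) * Matrix.trace A - Matrix.trace (S * A)) / ((d : ℂ) * ((d : ℂ) ^ 2 - 1))) •
          (1 : Matrix (Fin d × Fin d) (Fin d × Fin d) ℂ) +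
        (((d : ℂ) * Matrix.trace (S * A) - Matrix.trace A) / ((d : ℂ) * ((d : ℂ) ^ 2 - 1))) •
          S := by
  obtain rfl := eq_swapMatrix_of_mulVec hS
  have : Nontrivial (Fin d) := Fin.nontrivial_iff_two_le.2 hd
  have htr := trace_mul_twirl μ A 1 (by simp)
  have htrS := trace_mul_twirl μ A (swapMatrix (Fin d)) swapMatrix_mul_kronecker_self
  obtain ⟨a, b, hab⟩ := exists_eq_smul_one_add_smul_swapMatrix
    fun V hV => kronecker_mul_twirl μ A hV
  rw [hab] at htr htrS ⊢
  simp only [Matrix.mul_add, Matrix.mul_smul, swapMatrix_mul_self, Matrix.trace_add,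
    Matrix.trace_smul, trace_swapMatrix, Matrix.trace_one, Fintype.card_prod, Fintype.card_fin,
    Nat.cast_mul, Matrix.mul_one, Matrix.one_mul, smul_eq_mul] at htr htrS
  have hd0 : (d : ℂ) ≠ 0 := by exact_mod_cast (by omega : d ≠ 0)
  have hd1 : (d : ℂ) ^ 2 - 1 ≠ 0 := by
    rw [sub_ne_zero]
    exact_mod_cast (by nlinarith : d ^ 2 ≠ 1)
  rw [← htr, ← htrS]
  congr 2
  · field_simp
    ring
  · field_simp
    ring
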